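/- Let S be a set of states, A a nonempty set of actions, T : S × A → S a deterministic transition function, and r : S × A → ℝ a bounded reward function. Let γ_0, ..., γ_D ∈ (0,1), let w ∈ ℝ^{D+1}, let η(t) := Σ_{d=0}^D w_d Φ_d(t), and let f^n(η)(t) := Σ_{d=0}^D (Γ^n w)_d Φ_d(t). Then for every H ∈ ℕ and every state s ∈ S: V*_η(s) = sup over finite action sequences (a_0,...,a_H) ∈ A^{H+1} of [ Σ_{t=0}^H (Σ_{d=0}^D (Γ^t w)_d) · r(s_t, a_t) + V*_{f^{H+1}(η)}(s_{H+1}) ], where s_0 = s and s_{t+1} = T(s_t, a_t). -/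

import Mathlib

/-- `Phi γ d t = Σ_{(a_0,...,a_d) ∈ ℕ^{d+1}, a_0+...+a_d = t} ∏_{i=0}^{d} γ_i^{a_i}`. -/
noncomputable def Phi (γ : ℕ → ℝ) (d t : ℕ) : ℝ :=
  ∑ a ∈ Finset.Nat.antidiagonalTuple (d + 1) t, ∏ i : Fin (d + 1), γ i ^ a i

/-- `Gam γ D` is the (D+1)×(D+1) matrix with `Γ_{ij} = γ_i` if `i ≤ j`, else `0`. -/
def Gam (γ : ℕ → ℝ) (D : ℕ) : Matrix (Fin (D + 1)) (Fin (D + 1)) ℝ :=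
  Matrix.of fun i j => if i ≤ j then γ i else 0

/-- Deterministic trajectory: `s_0 = s`, `s_{t+1} = T(s_t, a_t)`. -/
def traj {S A : Type*} (T : S → A → S) (s : S) (a : ℕ → A) : ℕ → S
  | 0 => s
  | t + 1 => T (traj T s a t) (a t)

/-- Optimal value for weights `η`: sup over action sequences of `Σ_t η(t) r(s_t, a_t)`. -/
noncomputable def Vstar {S A : Type*} (T : S → A → S) (r : S → A → ℝ) (η : ℕ → ℝ) (s : S) : ℝ :=
  ⨆ a : ℕ → A, ∑' t, η t * r (traj T s a t) (a t)

/-- Extension of a finite action sequence `(a_0,...,a_H)` to an infinite one (arbitrary tail). -/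
noncomputable def extSeq {A : Type*} [Nonempty A] (H : ℕ) (a : Fin (H + 1) → A) : ℕ → A :=
  fun t => if h : t < H + 1 then a ⟨t, h⟩ else Classical.arbitrary A

theorem Phi_zero_left (γ : ℕ → ℝ) (t : ℕ) : Phi γ 0 t = γ 0 ^ t := by
  simp [Phi, Finset.Nat.antidiagonalTuple_one]

theorem Phi_zero_right (γ : ℕ → ℝ) (d : ℕ) : Phi γ d 0 = 1 := by
  simp [Phi, Finset.Nat.antidiagonalTuple_zero_right]

/-- Splitting off the first discount factor. -/
theorem Phi_succ_left (γ : ℕ → ℝ) (d t : ℕ) :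
    Phi γ (d + 1) t =
      ∑ p ∈ Finset.HasAntidiagonal.antidiagonal t, γ 0 ^ p.1 * Phi (fun i => γ (i + 1)) d p.2 := by
  simp only [Phi, Finset.mul_sum]
  rw [Finset.sum_sigma']
  symm
  refine Finset.sum_bij' (fun x _ => Fin.cons x.1.1 x.2)
    (fun a _ => ⟨(a 0, ∑ i : Fin (d + 1), a i.succ), Fin.tail a⟩) ?_ ?_ ?_ ?_ ?_
  · rintro ⟨⟨i, j⟩, a⟩ h
    simp only [Finset.mem_sigma, Finset.HasAntidiagonal.mem_antidiagonal,
      Finset.Nat.mem_antidiagonalTuple] at h ⊢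
    rw [Fin.sum_univ_succ]
    simp only [Fin.cons_zero, Fin.cons_succ]
    rw [h.2, h.1]
  · intro a h
    simp only [Finset.mem_sigma, Finset.HasAntidiagonal.mem_antidiagonal,
      Finset.Nat.mem_antidiagonalTuple] at h ⊢
    rw [Fin.sum_univ_succ] at h
    exact ⟨h, rfl⟩
  · rintro ⟨⟨i, j⟩, a⟩ h
    simp only [Finset.mem_sigma, Finset.HasAntidiagonal.mem_antidiagonal,
      Finset.Nat.mem_antidiagonalTuple] at h
    obtain ⟨-, rfl⟩ := h
    simp
  · intro a h
    simp
  · rintro ⟨⟨i, j⟩, a⟩ h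
    simp [Fin.prod_univ_succ]

/-- Splitting off the last discount factor. -/
theorem Phi_succ_succ (γ : ℕ → ℝ) (d t : ℕ) :
    Phi γ (d + 1) (t + 1) = Phi γ d (t + 1) + γ (d + 1) * Phi γ (d + 1) t := by
  induction d generalizing γ t with
  | zero =>
    simp only [Phi_succ_left, Phi_zero_left]
    rw [Finset.Nat.sum_antidiagonal_succ', Finset.mul_sum]
    simp only [pow_zero, mul_one, zero_add]
    congr 1
    exact Finset.sum_congr rfl fun p _ => by ring
  | succ d ih =>
    rw [Phi_succ_left γ (d + 1) (t + 1), Phi_succ_left γ (d + 1) t, Phi_succ_left γ d (t + 1),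
      Finset.Nat.sum_antidiagonal_succ', Finset.Nat.sum_antidiagonal_succ', Finset.mul_sum]
    simp only [ih, Phi_zero_right, mul_add, Finset.sum_add_distrib]
    rw [← add_assoc]
    congr 1
    exact Finset.sum_congr rfl fun p _ => by ring

theorem Phi_succ_right (γ : ℕ → ℝ) (d t : ℕ) :
    Phi γ d (t + 1) = ∑ j ∈ Finset.range (d + 1), γ j * Phi γ j t := by
  induction d with
  | zero => simp [Phi_zero_left, pow_succ']
  | succ d ih => rw [Phi_succ_succ, ih, Finset.sum_range_succ _ (d + 1)]

theorem summable_norm_Phi (γ : ℕ → ℝ) (d : ℕ) (hγ : ∀ i ≤ d, ‖γ i‖ < 1) :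
    Summable fun t => ‖Phi γ d t‖ := by
  induction d generalizing γ with
  | zero =>
    simp only [Phi_zero_left, norm_pow]
    exact summable_geometric_of_lt_one (norm_nonneg _) (hγ 0 le_rfl)
  | succ d ih =>
    simp only [Phi_succ_left]
    refine summable_norm_sum_mul_antidiagonal_of_summable_norm (f := fun n => γ 0 ^ n) ?_
      (ih (fun i => γ (i + 1)) fun i hi => hγ (i + 1) (by omega))
    simp only [norm_pow]
    exact summable_geometric_of_lt_one (norm_nonneg _) (hγ 0 (by omega))

theorem sum_mul_Phi_succ (γ : ℕ → ℝ) (D : ℕ) (w : Fin (D + 1) → ℝ) (t : ℕ) :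
    ∑ d : Fin (D + 1), w d * Phi γ d (t + 1) =
      ∑ d : Fin (D + 1), ((Gam γ D).mulVec w) d * Phi γ d t := by
  have key (d : Fin (D + 1)) :
      Phi γ d (t + 1) = ∑ j : Fin (D + 1), if j ≤ d then γ j * Phi γ j t else 0 := by
    rw [Phi_succ_right]
    simp only [Fin.le_def]
    rw [Fin.sum_univ_eq_sum_range (fun j => if j ≤ (d : ℕ) then γ j * Phi γ j t else 0),
      ← Finset.sum_filter]
    refine Finset.sum_congr ?_ fun _ _ => rfl
    ext j
    simp only [Finset.mem_range, Finset.mem_filter]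
    omega
  simp only [key, Matrix.mulVec, dotProduct, Gam, Matrix.of_apply, Finset.mul_sum,
    Finset.sum_mul]
  rw [Finset.sum_comm]
  refine Finset.sum_congr rfl fun j _ => Finset.sum_congr rfl fun d _ => ?_
  split_ifs <;> ring

theorem sum_mul_Phi_add (γ : ℕ → ℝ) (D : ℕ) (w : Fin (D + 1) → ℝ) (n t : ℕ) :
    ∑ d : Fin (D + 1), w d * Phi γ d (t + n) =
      ∑ d : Fin (D + 1), ((Gam γ D ^ n).mulVec w) d * Phi γ d t := by
  induction n generalizing t with
  | zero => simp
  | succ n ih =>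
    rw [← add_assoc, add_right_comm, ih, sum_mul_Phi_succ, Matrix.mulVec_mulVec, ← pow_succ']

section Trajectory

variable {S A : Type*} (T : S → A → S) (r : S → A → ℝ)

theorem traj_congr (s : S) {a b : ℕ → A} {n : ℕ} (h : ∀ t < n, a t = b t) :
    traj T s a n = traj T s b n := by
  induction n with
  | zero => rfl
  | succ n ih =>
    simp only [traj]
    rw [ih fun t ht => h t (by omega), h n (by omega)]

theorem traj_add (s : S) (a : ℕ → A) (n t : ℕ) :
    traj T s a (t + n) = traj T (traj T s a n) (fun k => a (k + n)) t := by
  induction t with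
  | zero => simp [traj]
  | succ t ih =>
    rw [add_right_comm]
    simp only [traj, ih]

variable {r} {C : ℝ} (hC : ∀ s a, |r s a| ≤ C) {η : ℕ → ℝ} (hη : Summable fun t => ‖η t‖)
include hC hη

theorem summable_discounted (s : S) (a : ℕ → A) :
    Summable fun t => η t * r (traj T s a t) (a t) :=
  Summable.of_norm_bounded (hη.mul_right C) fun t => by
    rw [norm_mul]
    exact mul_le_mul_of_nonneg_left (hC _ _) (norm_nonneg _)

theorem bddAbove_discounted (s : S) :
    BddAbove (Set.range fun a : ℕ → A => ∑' t, η t * r (traj T s a t) (a t)) := by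
  refine ⟨∑' t, ‖η t‖ * C, ?_⟩
  rintro _ ⟨a, rfl⟩
  refine (summable_discounted T hC hη s a).tsum_le_tsum (fun t => ?_) (hη.mul_right C)
  refine (Real.le_norm_self _).trans ?_
  rw [norm_mul]
  exact mul_le_mul_of_nonneg_left (hC _ _) (norm_nonneg _)

theorem discounted_split (s : S) (a : ℕ → A) (n : ℕ) :
    ∑' t, η t * r (traj T s a t) (a t) =
      ∑ t ∈ Finset.range n, η t * r (traj T s a t) (a t) +
        ∑' t, η (t + n) * r (traj T (traj T s a n) (fun k => a (k + n)) t) (a (t + n)) := by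
  rw [← (summable_discounted T hC hη s a).sum_add_tsum_nat_add n]
  simp only [traj_add]

/-- Bellman decomposition for arbitrary absolutely summable weights. -/
theorem Vstar_eq_iSup [Nonempty A] (H : ℕ) (s : S) :
    Vstar T r η s =
      ⨆ a : Fin (H + 1) → A,
        ((∑ t ∈ Finset.range (H + 1), η t * r (traj T s (extSeq H a) t) (extSeq H a t))
          + Vstar T r (fun t => η (t + (H + 1))) (traj T s (extSeq H a) (H + 1))) := by
  have value_split (b : Fin (H + 1) → A) (a : ℕ → A) (h : ∀ i : Fin (H + 1), a i = b i) :
      ∑' t, η t * r (traj T s a t) (a t) =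
        ∑ t ∈ Finset.range (H + 1), η t * r (traj T s (extSeq H b) t) (extSeq H b t) +
          ∑' t, η (t + (H + 1)) * r (traj T (traj T s (extSeq H b) (H + 1))
            (fun k => a (k + (H + 1))) t) (a (t + (H + 1))) := by
    have hab : ∀ t < H + 1, a t = extSeq H b t := fun t ht => by
      rw [extSeq, dif_pos ht]
      exact h ⟨t, ht⟩
    rw [discounted_split T hC hη s a (H + 1), traj_congr T s hab]
    congr 1
    refine Finset.sum_congr rfl fun t ht => ?_
    rw [Finset.mem_range] at ht
    rw [traj_congr T s fun k hk => hab k (hk.trans ht), hab t ht]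
  have le_value (b : Fin (H + 1) → A) :
      ∑ t ∈ Finset.range (H + 1), η t * r (traj T s (extSeq H b) t) (extSeq H b t)
        + Vstar T r (fun t => η (t + (H + 1))) (traj T s (extSeq H b) (H + 1))
        ≤ Vstar T r η s := by
    rw [← le_sub_iff_add_le']
    refine ciSup_le fun c => ?_
    rw [le_sub_iff_add_le']
    have e := value_split b (fun t => if t < H + 1 then extSeq H b t else c (t - (H + 1)))
      fun i => by simp [extSeq, Nat.lt_succ_iff.1 i.2]
    have hlt (t : ℕ) : ¬ t + (H + 1) < H + 1 := by omega
    simp only [hlt, if_false, Nat.add_sub_cancel] at e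
    rw [← e]
    exact le_ciSup (bddAbove_discounted T hC hη s) _
  apply le_antisymm
  · refine ciSup_le fun a => ?_
    refine le_ciSup_of_le ⟨_, Set.forall_mem_range.2 le_value⟩ (fun i => a i) ?_
    rw [value_split (fun i => a i) a fun _ => rfl]
    exact add_le_add_right (le_ciSup (bddAbove_discounted T hC
      ((summable_nat_add_iff (f := fun t => ‖η t‖) (H + 1)).2 hη) _) fun k => a (k + (H + 1))) _
  · exact ciSup_le le_value

end Trajectory

/-- Proposition 2, deterministic dynamics. H-step Bellman decomposition:
`V*_η(s) = sup_{(a_0,...,a_H)} [ Σ_{t=0}^H ⟨1, Γ^t w⟩ r(s_t,a_t) + V*_{f^{H+1}(η)}(s_{H+1}) ]`,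
where `η(t) = Σ_d w_d Φ_d(t)` and `[f^n(η)](t) = Σ_d (Γ^n w)_d Φ_d(t)`. -/
theorem stmt1 {S A : Type*} [Nonempty A] (T : S → A → S) (r : S → A → ℝ)
    (hr : ∃ C, ∀ s a, |r s a| ≤ C)
    (D : ℕ) (γ : ℕ → ℝ) (hγ : ∀ d ≤ D, 0 < γ d ∧ γ d < 1)
    (w : Fin (D + 1) → ℝ) (H : ℕ) (s : S) :
    Vstar T r (fun t => ∑ d : Fin (D + 1), w d * Phi γ d t) s =
      ⨆ a : Fin (H + 1) → A,
        ((∑ t ∈ Finset.range (H + 1),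
            (∑ d : Fin (D + 1), ((Gam γ D ^ t).mulVec w) d)
              * r (traj T s (extSeq H a) t) (extSeq H a t))
          + Vstar T r (fun t => ∑ d : Fin (D + 1), ((Gam γ D ^ (H + 1)).mulVec w) d * Phi γ d t)
              (traj T s (extSeq H a) (H + 1))) := by
  obtain ⟨C, hC⟩ := hr
  have hη : Summable fun t => ‖∑ d : Fin (D + 1), w d * Phi γ d t‖ := by
    refine Summable.of_nonneg_of_le (fun _ => norm_nonneg _) (fun t => norm_sum_le _ _)
      (summable_sum fun d _ => ?_)
    simp only [norm_mul]
    refine (summable_norm_Phi γ d fun i hi => ?_).mul_left _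
    obtain ⟨h0, h1⟩ := hγ i (by omega)
    rwa [Real.norm_of_nonneg h0.le]
  have hη_eq (t : ℕ) : ∑ d : Fin (D + 1), w d * Phi γ d t =
      ∑ d : Fin (D + 1), ((Gam γ D ^ t).mulVec w) d := by
    simpa [Phi_zero_right] using sum_mul_Phi_add γ D w t 0
  rw [Vstar_eq_iSup T hC hη H s]
  simp only [sum_mul_Phi_add γ D w (H + 1)]
  simp only [hη_eq]
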